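/- A ring R is left perfect if and only if R is semilocal, the module R is reduced (as a left R-module), and the free left R-module R^(ℕ) is Rad-supplementing. -/

import Mathlib

universe u v

/-- The radical of a module: the intersection of all maximal submodules. -/
def moduleRad (R : Type u) [Ring R] (M : Type v) [AddCommGroup M] [Module R M] :
    Submodule R M :=
  sInf {m : Submodule R M | IsCoatom m}

/-- `V` is a Rad-supplement of `U` in the ambient module: `U + V = ⊤` and
`U ⊓ V ≤ Rad V` (viewed inside the ambient module). -/
def IsRadSupplementOf (R : Type u) [Ring R] {N : Type v} [AddCommGroup N] [Module R N]
    (U V : Submodule R N) : Prop :=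
  U ⊔ V = ⊤ ∧ U ⊓ V ≤ Submodule.map V.subtype (moduleRad R V)

/-- `M` is Rad-supplementing: in every module containing it (i.e. every embedding into a
module `N`), its image has a Rad-supplement. -/
def IsRadSupplementing (R : Type u) [Ring R] (M : Type v) [AddCommGroup M] [Module R M] :
    Prop :=
  ∀ (N : ModuleCat.{v} R) (f : M →ₗ[R] N), Function.Injective f →
    ∃ V : Submodule R N, IsRadSupplementOf R (LinearMap.range f) V

/-- `M` has a projective cover: a projective module `P` with a surjection onto `M`
whose kernel is small in `P`. -/
def HasProjectiveCover (R : Type u) [Ring R] (M : Type u) [AddCommGroup M]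
    [Module R M] : Prop :=
  ∃ (P : ModuleCat.{u} R), Module.Projective R P ∧
    ∃ p : (P : Type u) →ₗ[R] M, Function.Surjective p ∧
      ∀ T : Submodule R (P : Type u), T ≠ ⊤ → LinearMap.ker p ⊔ T = ⊤ → False

/-- `R` is left perfect: every left `R`-module has a projective cover. -/
def IsLeftPerfect (R : Type u) [Ring R] : Prop :=
  ∀ (M : ModuleCat.{u} R), HasProjectiveCover R M

/-- A module is reduced if it has no nonzero radical submodule. -/
def IsReducedModule (R : Type u) [Ring R] (M : Type v) [AddCommGroup M]
    [Module R M] : Prop :=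
  ∀ U : Submodule R M, moduleRad R U = ⊤ → U = ⊥

open Submodule

section Jacobson

variable {R : Type u} [Ring R]

theorem moduleRad_eq_jacobson (M : Type v) [AddCommGroup M] [Module R M] :
    moduleRad R M = Module.jacobson R M := rfl

theorem exists_one_sub_mul_eq_one_of_mem_jacobson {a : R} (ha : a ∈ Ring.jacobson R) :
    ∃ v, (1 - a) * v = 1 := by
  have left_inv (b : R) (hb : b ∈ Ring.jacobson R) : ∃ z, z * (1 - b) = 1 := by
    rw [← Ideal.jacobson_bot, Ideal.mem_jacobson_iff] at hb
    obtain ⟨z, hz⟩ := hb (-1)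
    refine ⟨z, ?_⟩
    rw [Submodule.mem_bot] at hz
    rw [← sub_eq_zero, ← hz]
    noncomm_ring
  obtain ⟨z, hz⟩ := left_inv a ha
  obtain ⟨w, hw⟩ := left_inv (-(z * a)) (neg_mem (Ideal.mul_mem_left _ z ha))
  have h_eq : 1 - -(z * a) = z := by
    rw [mul_sub, mul_one, sub_eq_iff_eq_add] at hz
    rw [sub_neg_eq_add, ← hz]
  rw [h_eq] at hw
  have hwz : w = 1 - a := by
    calc w = w * (z * (1 - a)) := by rw [hz, mul_one]
      _ = 1 - a := by rw [← mul_assoc, hw, one_mul]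
  exact ⟨z, hwz ▸ hw⟩

/-- A form of Nakayama's lemma for rows over a noncommutative ring: a finite row fixed by a
matrix with entries in the Jacobson radical vanishes. -/
theorem eq_zero_of_eq_sum_mul_jacobson {ι : Type*} (x : ι → R) (s : Finset ι) (a : ι → ι → R)
    (ha : ∀ k j, a k j ∈ Ring.jacobson R) (hx : ∀ j ∈ s, x j = ∑ k ∈ s, x k * a k j) :
    ∀ j ∈ s, x j = 0 := by
  classical
  induction s using Finset.induction_on generalizing a with
  | empty => simp
  | insert n s hn ih =>
    obtain ⟨v, hv⟩ := exists_one_sub_mul_eq_one_of_mem_jacobson (ha n n)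
    have hxn : x n = ∑ k ∈ s, x k * (a k n * v) := by
      have h := hx n (Finset.mem_insert_self n s)
      rw [Finset.sum_insert hn] at h
      calc x n = (x n - x n * a n n) * v := by rw [← mul_one_sub, mul_assoc, hv, mul_one]
        _ = (∑ k ∈ s, x k * a k n) * v := by rw [sub_eq_of_eq_add' h]
        _ = _ := by rw [Finset.sum_mul]; simp only [mul_assoc]
    have hs : ∀ j ∈ s, x j = 0 := by
      refine ih (fun k j ↦ a k n * v * a n j + a k j)
        (fun k j ↦ add_mem (Ideal.mul_mem_left _ _ (ha n j)) (ha k j)) fun j hj ↦ ?_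
      have h := hx j (Finset.mem_insert_of_mem hj)
      rw [Finset.sum_insert hn, hxn, Finset.sum_mul, ← Finset.sum_add_distrib] at h
      rw [h]
      simp only [mul_add, mul_assoc]
    intro j hj
    obtain rfl | hj := Finset.mem_insert.mp hj
    · rw [hxn]
      exact Finset.sum_eq_zero fun k hk ↦ by rw [hs k hk, zero_mul]
    · exact hs j hj

/-- A projective module that coincides with its radical is zero. -/
theorem Module.Projective.subsingleton_of_jacobson_eq_top {P : Type*} [AddCommGroup P]
    [Module R P] [Module.Projective R P] (h : Module.jacobson R P = ⊤) : Subsingleton P := by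
  obtain ⟨i, hi⟩ := (Module.projective_def' (R := R) (P := P)).mp inferInstance
  have hi' (p : P) : Finsupp.linearCombination R id (i p) = p := LinearMap.congr_fun hi p
  have mem (p j : P) : i p j ∈ Ring.jacobson R :=
    Module.le_comap_jacobson ((Finsupp.lapply j : (P →₀ R) →ₗ[R] R) ∘ₗ i) (h ▸ mem_top)
  refine subsingleton_of_forall_eq 0 fun p ↦ ?_
  have key := eq_zero_of_eq_sum_mul_jacobson (i p) (i p).support (fun k j ↦ i k j)
    (fun k j ↦ mem k j) fun j _ ↦ by
      conv_lhs => rw [← hi' p, Finsupp.linearCombination_apply, Finsupp.sum, map_sum]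
      simp [Finsupp.finsetSum_apply]
  have : i p = 0 := by
    ext j
    by_contra hj
    exact hj (key j (Finsupp.mem_support_iff.mpr hj))
  rw [← hi' p, this, map_zero]

theorem le_jacobson_of_small {P : Type*} [AddCommGroup P] [Module R P] {K : Submodule R P}
    (hK : ∀ T : Submodule R P, T ≠ ⊤ → K ⊔ T = ⊤ → False) : K ≤ Module.jacobson R P := by
  refine le_sInf fun m hm ↦ ?_
  by_contra hle
  exact hK m hm.1 (hm.2 _ (right_lt_sup.mpr hle))

end Jacobson

section Perfect

variable {R : Type u} [Ring R]

theorem exists_isRadSupplementOf_of_hasProjectiveCover {N : Type u} [AddCommGroup N] [Module R N]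
    (U : Submodule R N) (h : HasProjectiveCover R (N ⧸ U)) :
    ∃ V : Submodule R N, IsRadSupplementOf R U V := by
  obtain ⟨P, hP, p, hp, hsmall⟩ := h
  obtain ⟨f, hf⟩ := Module.projective_lifting_property U.mkQ p U.mkQ_surjective
  have hf' (y : P) : U.mkQ (f y) = p y := LinearMap.congr_fun hf y
  refine ⟨LinearMap.range f, eq_top_iff.mpr fun x _ ↦ ?_, ?_⟩
  · obtain ⟨y, hy⟩ := hp (U.mkQ x)
    rw [← hf', ← sub_eq_zero, ← map_sub, ← LinearMap.mem_ker, ker_mkQ] at hy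
    exact mem_sup.mpr ⟨x - f y, by simpa using neg_mem hy, f y, ⟨y, rfl⟩, by simp⟩
  · rintro x ⟨hxU, y, rfl⟩
    have hy : p y = 0 := by
      rw [← hf', ← LinearMap.mem_ker, ker_mkQ]; exact hxU
    have hy' : y ∈ Module.jacobson R P := le_jacobson_of_small hsmall hy
    exact ⟨f.rangeRestrict y, Module.le_comap_jacobson f.rangeRestrict hy', rfl⟩

theorem subsingleton_of_jacobson_eq_top_of_hasProjectiveCover {M : Type u} [AddCommGroup M]
    [Module R M] (h : HasProjectiveCover R M) (hM : Module.jacobson R M = ⊤) :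
    Subsingleton M := by
  obtain ⟨P, hP, p, hp, hsmall⟩ := h
  have hPtop : Module.jacobson R P = ⊤ := by
    rw [← Module.comap_jacobson_of_ker_le hp (le_jacobson_of_small hsmall), hM, comap_top]
  have := Module.Projective.subsingleton_of_jacobson_eq_top hPtop
  exact hp.subsingleton

namespace IsLeftPerfect

theorem exists_isRadSupplementOf (h : IsLeftPerfect R) {N : Type u} [AddCommGroup N]
    [Module R N] (U : Submodule R N) : ∃ V : Submodule R N, IsRadSupplementOf R U V :=
  exists_isRadSupplementOf_of_hasProjectiveCover U (h (ModuleCat.of R (N ⧸ U)))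

theorem isRadSupplementing (h : IsLeftPerfect R) (M : Type u) [AddCommGroup M] [Module R M] :
    IsRadSupplementing R M :=
  fun _ _ _ ↦ h.exists_isRadSupplementOf _

theorem isReducedModule (h : IsLeftPerfect R) (M : Type u) [AddCommGroup M] [Module R M] :
    IsReducedModule R M :=
  fun U hU ↦ subsingleton_iff_eq_bot.mp <|
    subsingleton_of_jacobson_eq_top_of_hasProjectiveCover (h (ModuleCat.of R U)) hU

theorem isSemisimpleModule_of_jacobson_eq_bot (h : IsLeftPerfect R) {M : Type u}
    [AddCommGroup M] [Module R M] (hM : Module.jacobson R M = ⊥) : IsSemisimpleModule R M := by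
  refine (isSemisimpleModule_iff R M).mpr ⟨fun U ↦ ?_⟩
  obtain ⟨V, hV, hle⟩ := h.exists_isRadSupplementOf U
  refine ⟨V, disjoint_iff_inf_le.mpr (hle.trans ?_), codisjoint_iff.mpr hV⟩
  exact (Module.map_jacobson_le V.subtype).trans hM.le

end IsLeftPerfect

end Perfect

section TNilpotent

variable {R : Type u} [Ring R]

/-- An ideal is left T-nilpotent if the partial products `a 0 * ⋯ * a (n - 1)` of every sequence
of its elements eventually vanish. -/
def Ideal.IsLeftTNilpotent (I : Ideal R) : Prop :=
  ∀ a p : ℕ → R, (∀ i, a i ∈ I) → p 0 = 1 → (∀ n, p (n + 1) = p n * a n) → ∃ n, p n = 0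

theorem Ideal.IsLeftTNilpotent.isNilpotent {I : Ideal R} (hI : I.IsLeftTNilpotent) {a : R}
    (ha : a ∈ I) : IsNilpotent a :=
  hI (fun _ ↦ a) (a ^ ·) (fun _ ↦ ha) (pow_zero a) (pow_succ a)

/-- Nakayama's lemma for left T-nilpotent ideals. -/
theorem Ideal.IsLeftTNilpotent.subsingleton {I : Ideal R} (hI : I.IsLeftTNilpotent) {M : Type*}
    [AddCommGroup M] [Module R M] (h : I • (⊤ : Submodule R M) = ⊤) : Subsingleton M := by
  by_contra hM
  rw [not_subsingleton_iff_nontrivial] at hM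
  have step (p : {p : R // ∃ m : M, p • m ≠ 0}) : ∃ a ∈ I, ∃ m : M, (p.1 * a) • m ≠ 0 := by
    obtain ⟨p, m, hm⟩ := p
    by_contra! hp
    have hmem : m ∈ I • (⊤ : Submodule R M) := by
      rw [h]; exact mem_top
    refine hm (smul_induction_on hmem (p := fun m ↦ p • m = 0) (fun a ha m _ ↦ ?_)
      fun x y hx hy ↦ ?_)
    · rw [← mul_smul]; exact hp a ha m
    · rw [smul_add, hx, hy, add_zero]
  choose a haI ha using step
  obtain ⟨m, hm⟩ := exists_ne (0 : M)
  let q : ℕ → {p : R // ∃ m : M, p • m ≠ 0} :=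
    Nat.rec ⟨1, m, by rwa [one_smul]⟩ fun _ p ↦ ⟨p.1 * a p, ha p⟩
  obtain ⟨n, hn⟩ := hI (fun n ↦ a (q n)) (fun n ↦ (q n).1) (fun n ↦ haI _) rfl fun _ ↦ rfl
  obtain ⟨m, hm⟩ := (q n).2
  exact hm (by rw [show (q n).1 = 0 from hn, zero_smul])

theorem Ideal.IsLeftTNilpotent.eq_top_of_smul_top_sup_eq_top {I : Ideal R}
    (hI : I.IsLeftTNilpotent) {M : Type*} [AddCommGroup M] [Module R M] {T : Submodule R M}
    (h : I • (⊤ : Submodule R M) ⊔ T = ⊤) : T = ⊤ := by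
  rw [← Submodule.Quotient.subsingleton_iff]
  refine hI.subsingleton ?_
  have := congrArg (Submodule.map T.mkQ) h
  rwa [Submodule.map_sup, mkQ_map_self, sup_bot_eq, map_smul'', Submodule.map_top,
    range_mkQ] at this

end TNilpotent

section Bass

variable {R : Type u} [Ring R]

/-- The endomorphism of `R^(ℕ)` sending the basis vector `e i` to `e i - a i • e (i + 1)`. -/
noncomputable def bassMap (a : ℕ → R) : (ℕ →₀ R) →ₗ[R] (ℕ →₀ R) :=
  Finsupp.linearCombination R fun i ↦ Finsupp.single i 1 - Finsupp.single (i + 1) (a i)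

theorem bassMap_single (a : ℕ → R) (i : ℕ) :
    bassMap a (Finsupp.single i 1) = Finsupp.single i 1 - a i • Finsupp.single (i + 1) 1 := by
  simp [bassMap]

theorem bassMap_apply_zero (a : ℕ → R) (r : ℕ →₀ R) : bassMap a r 0 = r 0 := by
  induction r using Finsupp.induction_linear with
  | zero => simp
  | add x y hx hy => simp [hx, hy]
  | single i r => cases i <;> simp [bassMap]

theorem bassMap_apply_succ (a : ℕ → R) (r : ℕ →₀ R) (n : ℕ) :
    bassMap a r (n + 1) = r (n + 1) - r n * a n := by
  induction r using Finsupp.induction_linear with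
  | zero => simp
  | add x y hx hy => simp [hx, hy]; noncomm_ring
  | single i r =>
    obtain rfl | h := eq_or_ne i n
    · simp [bassMap]
    · simp [bassMap, Finsupp.single_apply, h]

theorem bassMap_injective (a : ℕ → R) : Function.Injective (bassMap a) := by
  refine (injective_iff_map_eq_zero _).mpr fun r hr ↦ Finsupp.ext fun n ↦ ?_
  induction n with
  | zero => rw [← bassMap_apply_zero a, hr]
  | succ n ih =>
    have h := bassMap_apply_succ a r n
    rw [ih, hr] at h
    simpa using h.symm

theorem IsReducedModule.finsupp (hR : IsReducedModule R R) (ι : Type*) :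
    IsReducedModule R (ι →₀ R) := by
  intro U hU
  refine eq_bot_iff.mpr fun x hx ↦ Finsupp.ext fun i ↦ ?_
  let f : U →ₗ[R] R := Finsupp.lapply i ∘ₗ U.subtype
  have hf : LinearMap.range f = ⊥ := hR _ <| by
    rw [moduleRad_eq_jacobson] at hU ⊢
    refine eq_top_iff.mpr fun y _ ↦ ?_
    obtain ⟨u, rfl⟩ := f.surjective_rangeRestrict y
    exact Module.le_comap_jacobson f.rangeRestrict (hU ▸ mem_top)
  exact (mem_bot R).mp (hf ▸ ⟨⟨x, hx⟩, rfl⟩ : f ⟨x, hx⟩ ∈ (⊥ : Submodule R R))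

theorem IsRadSupplementing.exists_isRadSupplementOf {M N : Type v} [AddCommGroup M] [Module R M]
    [AddCommGroup N] [Module R N] (h : IsRadSupplementing R M) (f : M →ₗ[R] N)
    (hf : Function.Injective f) :
    ∃ V : Submodule R N, IsRadSupplementOf R (LinearMap.range f) V :=
  h (ModuleCat.of R N) f hf

theorem isLeftTNilpotent_jacobson (hred : IsReducedModule R R)
    (hsupp : IsRadSupplementing R (ℕ →₀ R)) : (Ring.jacobson R).IsLeftTNilpotent := by
  intro a p ha hp0 hp
  obtain ⟨V, hV, hle⟩ := hsupp.exists_isRadSupplementOf (bassMap a) (bassMap_injective a)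
  have hVrad : Module.jacobson R V = ⊤ := by
    refine sInf_eq_top.mpr fun m hm ↦ ?_
    have hjm : Module.jacobson R V ≤ m := sInf_le hm
    have hgen : LinearMap.range (bassMap a) ⊔ map V.subtype m = ⊤ := by
      refine eq_top_iff.mpr fun x _ ↦ ?_
      induction x using Finsupp.induction_linear with
      | zero => exact zero_mem _
      | add x y hx hy => exact add_mem (hx mem_top) (hy mem_top)
      | single i r =>
        have hmem : Finsupp.single (i + 1) (1 : R) ∈ LinearMap.range (bassMap a) ⊔ V :=
          hV ▸ mem_top
        obtain ⟨g, hg, v, hv, hgv⟩ := mem_sup.mp hmem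
        have hav : a i • (⟨v, hv⟩ : V) ∈ m :=
          hjm (Ring.jacobson_smul_top_le R V (smul_mem_smul (ha i) mem_top))
        have h1 : Finsupp.single i (1 : R) =
            (bassMap a (Finsupp.single i 1) + a i • g) + a i • v := by
          rw [bassMap_single, ← hgv, smul_add]
          abel
        rw [← mul_one r, ← smul_eq_mul, ← Finsupp.smul_single, h1]
        exact smul_mem _ _ (add_mem (mem_sup_left (add_mem ⟨_, rfl⟩ (smul_mem _ _ hg)))
          (mem_sup_right ⟨_, hav, rfl⟩))
    refine eq_top_iff.mpr fun x _ ↦ ?_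
    have hxmem : (x : ℕ →₀ R) ∈ LinearMap.range (bassMap a) ⊔ map V.subtype m :=
      hgen ▸ mem_top
    obtain ⟨g, hg, _, ⟨y, hy, rfl⟩, hgy⟩ := mem_sup.mp hxmem
    have hgV : g ∈ V := by
      rw [eq_sub_of_add_eq hgy]; exact sub_mem x.2 y.2
    obtain ⟨z, hz, rfl⟩ := hle ⟨hg, hgV⟩
    have hx : x = z + y := Subtype.ext hgy.symm
    exact hx ▸ add_mem (hjm hz) hy
  rw [hred.finsupp ℕ V hVrad, sup_bot_eq] at hV
  obtain ⟨r, hr⟩ := LinearMap.range_eq_top.mp hV (Finsupp.single 0 1)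
  have hrp (n : ℕ) : r n = p n := by
    induction n with
    | zero => rw [hp0, ← bassMap_apply_zero a, hr, Finsupp.single_eq_same]
    | succ n ih =>
      have h := bassMap_apply_succ a r n
      rw [hr, Finsupp.single_eq_of_ne (by simp), eq_comm, sub_eq_zero] at h
      rw [h, hp, ih]
  obtain ⟨n, hn⟩ := Infinite.exists_notMem_finset r.support
  exact ⟨n, by rw [← hrp, Finsupp.notMem_support_iff.mp hn]⟩

end Bass

section Cover

variable {R : Type u} [Ring R]

/-- A module killed by the radical of a semilocal ring is semisimple. -/
theorem isSemisimpleModule_of_jacobson_smul_eq_zero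
    [IsSemisimpleModule R (R ⧸ Ring.jacobson R)] {M : Type*} [AddCommGroup M] [Module R M]
    (h : ∀ a ∈ Ring.jacobson R, ∀ m : M, a • m = 0) : IsSemisimpleModule R M := by
  let f (m : M) : (R ⧸ Ring.jacobson R) →ₗ[R] M :=
    (Ring.jacobson R).liftQ (LinearMap.toSpanSingleton R M m) fun a ha ↦ h a ha m
  refine isSemisimpleModule_of_isSemisimpleModule_submodule' (p := fun m ↦ LinearMap.range (f m))
    (fun m ↦ IsSemisimpleModule.range (f m)) (eq_top_iff.mpr fun m _ ↦ ?_)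
  exact mem_iSup_of_mem m ⟨(Ring.jacobson R).mkQ 1, (liftQ_apply _ _ _).trans (one_smul R m)⟩

/-- If `R` is semilocal with nil radical, a cyclic module killed by the radical is
covered by a projective module. -/
theorem exists_projective_cover_of_cyclic [IsSemisimpleModule R (R ⧸ Ring.jacobson R)]
    (hnil : ∀ a ∈ Ring.jacobson R, IsNilpotent a) {S : Type*} [AddCommGroup S] [Module R S]
    (h : ∀ a ∈ Ring.jacobson R, ∀ m : S, a • m = 0) (s : S) (hs : span R {s} = ⊤) :
    ∃ (P : Submodule R R) (f : P →ₗ[R] S), Module.Projective R P ∧ Function.Surjective f ∧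
      LinearMap.ker f ≤ Ring.jacobson R • ⊤ := by
  let π : (R ⧸ Ring.jacobson R) →ₗ[R] S :=
    (Ring.jacobson R).liftQ (LinearMap.toSpanSingleton R S s) fun a ha ↦ h a ha s
  have hπ (r : R) : π ((Ring.jacobson R).mkQ r) = r • s := liftQ_apply _ _ _
  have hsurj (y : S) : ∃ r : R, r • s = y := mem_span_singleton.mp (hs ▸ mem_top)
  have : IsSemisimpleModule R S := isSemisimpleModule_of_jacobson_smul_eq_zero h
  obtain ⟨σ, hσ⟩ := IsSemisimpleModule.lifting_property π
    (fun y ↦ (hsurj y).imp' _ fun r hr ↦ (hπ r).trans hr) LinearMap.id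
  have hσ' (y : S) : π (σ y) = y := LinearMap.congr_fun hσ y
  obtain ⟨b, hb⟩ := (Ring.jacobson R).mkQ_surjective (σ s)
  have hbs : b • s = s := by rw [← hπ, hb, hσ']
  have hidem : IsIdempotentElem (Ideal.Quotient.mk (Ring.jacobson R) b) := by
    have h1 : (Ring.jacobson R).mkQ (b * b) = (Ring.jacobson R).mkQ b := by
      rw [← smul_eq_mul, map_smul, hb, ← map_smul, hbs]
    exact h1
  obtain ⟨e, he, heb⟩ := exists_isIdempotentElem_eq_of_ker_isNilpotent
    (Ideal.Quotient.mk (Ring.jacobson R))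
    (fun x hx ↦ hnil x (by rwa [Ideal.mk_ker] at hx)) _ ⟨b, rfl⟩ hidem
  rw [Ideal.Quotient.eq] at heb
  have hes : e • s = s := by
    rw [← sub_add_cancel e b, add_smul, h _ heb, zero_add, hbs]
  let g : R →ₗ[R] R := LinearMap.toSpanSingleton R R e
  have hg (r : R) : g r = r * e := rfl
  refine ⟨LinearMap.range g, LinearMap.toSpanSingleton R S s ∘ₗ (LinearMap.range g).subtype,
    .of_split (LinearMap.range g).subtype g.rangeRestrict ?_, fun y ↦ ?_, ?_⟩
  · ext ⟨_, r, rfl⟩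
    simp [hg, mul_assoc, he.eq]
  · obtain ⟨r, rfl⟩ := hsurj y
    exact ⟨⟨g r, r, rfl⟩, by simp [hg, mul_smul, hes]⟩
  · rintro ⟨_, r, rfl⟩ hr
    have hrs : r • s = 0 := by
      simpa [hg, mul_smul, hes] using hr
    have hrb : r * b ∈ Ring.jacobson R := by
      rw [← (Ring.jacobson R).ker_mkQ, LinearMap.mem_ker, ← smul_eq_mul, map_smul, hb, ← map_smul,
        hrs, map_zero]
    have hre : r * e ∈ Ring.jacobson R := by
      rw [← sub_add_cancel e b, mul_add]
      exact add_mem (Ideal.mul_mem_left _ r heb) hrb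
    have heq : (⟨g r, r, rfl⟩ : LinearMap.range g) = (r * e) • ⟨g 1, 1, rfl⟩ :=
      Subtype.ext (by simp [hg, mul_assoc, he.eq])
    rw [heq]
    exact smul_mem_smul hre mem_top

theorem exists_projective_cover_of_isSemisimpleModule
    [IsSemisimpleModule R (R ⧸ Ring.jacobson R)]
    (hnil : ∀ a ∈ Ring.jacobson R, IsNilpotent a) (M : Type u) [AddCommGroup M] [Module R M]
    [IsSemisimpleModule R M] :
    ∃ (P : ModuleCat.{u} R) (f : P →ₗ[R] M), Module.Projective R P ∧ Function.Surjective f ∧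
      LinearMap.ker f ≤ Ring.jacobson R • ⊤ := by
  classical
  obtain ⟨t, e, _, ht⟩ := IsSemisimpleModule.exists_linearEquiv_dfinsupp R M
  have hcov (S : t) : ∃ (P : Submodule R R) (f : P →ₗ[R] S.1), Module.Projective R P ∧
      Function.Surjective f ∧ LinearMap.ker f ≤ Ring.jacobson R • ⊤ := by
    have := ht S
    have := IsSimpleModule.nontrivial R S.1
    obtain ⟨s, hs⟩ := exists_ne (0 : S.1)
    refine exists_projective_cover_of_cyclic hnil (fun a ha m ↦ ?_) s
      (IsSimpleModule.span_singleton_eq_top R hs)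
    exact Module.mem_annihilator.mp (IsSemisimpleModule.jacobson_le_annihilator R S.1 ha) m
  choose P f hP hf hker using hcov
  refine ⟨ModuleCat.of R (Π₀ S, P S), e.symm.toLinearMap ∘ₗ DFinsupp.mapRange.linearMap f,
    inferInstanceAs (Module.Projective R (Π₀ S, P S)), e.symm.surjective.comp ?_, ?_⟩
  · exact (DFinsupp.mapRange_surjective _ fun S ↦ map_zero (f S)).mpr hf
  · intro x hx
    change (Π₀ S, P S) at x
    have hx' : DFinsupp.mapRange.linearMap f x = 0 :=
      e.symm.injective (by rw [map_zero]; exact hx)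
    change x ∈ (Ring.jacobson R • ⊤ : Submodule R (Π₀ S, P S))
    rw [← DFinsupp.sum_single (f := x)]
    refine sum_mem fun S _ ↦ ?_
    have hS : x S ∈ Ring.jacobson R • (⊤ : Submodule R (P S)) :=
      hker S (DFunLike.congr_fun hx' S)
    have := mem_map_of_mem (f := DFinsupp.lsingle (R := R) (M := fun S ↦ P S) S) hS
    rw [map_smul''] at this
    exact Submodule.smul_mono le_rfl le_top this

theorem isLeftPerfect_of_isLeftTNilpotent [IsSemisimpleModule R (R ⧸ Ring.jacobson R)]
    (hJ : (Ring.jacobson R).IsLeftTNilpotent) : IsLeftPerfect R := by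
  intro M
  let K : Submodule R M := Ring.jacobson R • ⊤
  have : IsSemisimpleModule R (M ⧸ K) := isSemisimpleModule_of_jacobson_smul_eq_zero <| by
    intro a ha m
    obtain ⟨m, rfl⟩ := K.mkQ_surjective m
    rw [← map_smul, ← LinearMap.mem_ker, ker_mkQ]
    exact smul_mem_smul ha mem_top
  obtain ⟨P, f, hP, hf, hker⟩ :=
    exists_projective_cover_of_isSemisimpleModule (fun a ↦ hJ.isNilpotent) (M ⧸ K)
  obtain ⟨p, hp⟩ := Module.projective_lifting_property K.mkQ f K.mkQ_surjective
  have hp' (y : P) : K.mkQ (p y) = f y := LinearMap.congr_fun hp y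
  refine ⟨P, hP, p, LinearMap.range_eq_top.mp (hJ.eq_top_of_smul_top_sup_eq_top ?_), ?_⟩
  · refine eq_top_iff.mpr fun x _ ↦ ?_
    obtain ⟨y, hy⟩ := hf (K.mkQ x)
    rw [← hp', eq_comm, ← sub_eq_zero, ← map_sub, ← LinearMap.mem_ker, ker_mkQ] at hy
    exact mem_sup.mpr ⟨x - p y, hy, p y, ⟨y, rfl⟩, by simp⟩
  · intro T hT hsup
    refine hT (hJ.eq_top_of_smul_top_sup_eq_top (eq_top_iff.mpr (hsup.ge.trans ?_)))
    refine sup_le_sup_right (le_trans (fun y hy ↦ ?_) hker) T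
    rw [LinearMap.mem_ker, ← hp', LinearMap.mem_ker.mp hy, map_zero]

end Cover

/-- `R` is left perfect iff `R` is semilocal, `R` is reduced as a left `R`-module,
and the free module `R^(ℕ)` is Rad-supplementing. -/
theorem isLeftPerfect_iff_semilocal_reduced_radSupplementing
    (R : Type u) [Ring R] :
    IsLeftPerfect R ↔
      (IsSemisimpleModule R (R ⧸ Ideal.jacobson (⊥ : Ideal R)) ∧
        IsReducedModule R R ∧ IsRadSupplementing R (ℕ →₀ R)) := by
  rw [Ideal.jacobson_bot]
  refine ⟨fun h ↦ ⟨h.isSemisimpleModule_of_jacobson_eq_bot (Module.jacobson_quotient_jacobson R R),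
    h.isReducedModule R, h.isRadSupplementing _⟩, fun ⟨_, hred, hsupp⟩ ↦ ?_⟩
  exact isLeftPerfect_of_isLeftTNilpotent (isLeftTNilpotent_jacobson hred hsupp)
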